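/- arXiv:2404.00296 — 2 statements merged into one kernel-verified Lean document; each statement's English description precedes it below -/
import Mathlib

section
/- Let Γ be a discrete group and let {χ_n : n ∈ ℕ} ⊆ Γ be such that, for each n, the order of χ_n is strictly larger than n. Put k(n) equal to the order of χ_n if that order is finite, and k(n) = n otherwise; set F_n = {χ_n^j : 1 ≤ j ≤ k(n)} and E = ⋃_{n∈ℕ} F_n. Then the closed ideal A_E(Γ) of the Fourier algebra A(Γ) is not reflexive. -/
noncomputable section
set_option synthInstance.maxHeartbeats 1000000
set_option maxHeartbeats 1000000

open Filter Topology
open scoped ENNReal NNReal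

section GroupSetup

variable (Γ : Type*) [Group Γ]

/-- `ℓ²(Γ)`. -/
abbrev l2 : Type _ := lp (fun _ : Γ => ℂ) 2

/-- Left translation by `γ` on `ℓ²(Γ)`, as a linear isometry: `(λ(γ) f)(x) = f(γ⁻¹ x)`. -/
def transIso (γ : Γ) : l2 Γ →ₗᵢ[ℂ] l2 Γ where
  toLinearMap :=
    { toFun := fun f => ⟨fun x => f (γ⁻¹ * x), by
        have hf := (memℓp_gen_iff (by norm_num : 0 < (2 : ℝ≥0∞).toReal)).1 (lp.memℓp f)
        exact memℓp_gen (((Equiv.mulLeft γ⁻¹).summable_iff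
          (f := fun y => ‖f y‖ ^ (2 : ℝ≥0∞).toReal)).2 hf)⟩
      map_add' := by intro f g; rfl
      map_smul' := by intro c f; rfl }
  norm_map' := by
    intro f
    rw [lp.norm_eq_tsum_rpow (by norm_num : 0 < (2 : ℝ≥0∞).toReal),
        lp.norm_eq_tsum_rpow (by norm_num : 0 < (2 : ℝ≥0∞).toReal)]
    congr 1
    exact (Equiv.mulLeft γ⁻¹).tsum_eq (f := fun y => ‖f y‖ ^ (2 : ℝ≥0∞).toReal)

/-- Left translation by `γ` as a bounded operator on `ℓ²(Γ)` (the left regular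
representation). -/
def Lop (γ : Γ) : l2 Γ →L[ℂ] l2 Γ := (transIso Γ γ).toContinuousLinearMap

end GroupSetup

section VNSetup

variable (Γ : Type*) [Group Γ]

/-- The group von Neumann algebra `VN(Γ)`: the double commutant of the left regular
representation inside `B(ℓ²(Γ))`. -/
def VNsub : Subalgebra ℂ (l2 Γ →L[ℂ] l2 Γ) :=
  Subalgebra.centralizer ℂ
    ((Subalgebra.centralizer ℂ (Set.range (Lop Γ)) : Subalgebra ℂ (l2 Γ →L[ℂ] l2 Γ)) :
      Set (l2 Γ →L[ℂ] l2 Γ))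

/-- The group von Neumann algebra as a type (a closed subspace of `B(ℓ²(Γ))`). -/
def VNt : Type _ := ↥(VNsub Γ)

instance : NormedAddCommGroup (VNt Γ) :=
  inferInstanceAs (NormedAddCommGroup ↥(Subalgebra.toSubmodule (VNsub Γ)))

instance : NormedSpace ℂ (VNt Γ) :=
  inferInstanceAs (NormedSpace ℂ ↥(Subalgebra.toSubmodule (VNsub Γ)))

/-- `λ(γ)` as an element of `VN(Γ)`. -/
def LopVN (γ : Γ) : VNt Γ :=
  ⟨Lop Γ γ, by
    rw [VNsub, Subalgebra.mem_centralizer_iff]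
    intro T hT
    exact ((Subalgebra.mem_centralizer_iff ℂ).1 hT (Lop Γ γ) ⟨γ, rfl⟩).symm⟩

/-- The inclusion `VN(Γ) → B(ℓ²(Γ))`. -/
def VNincl : VNt Γ →L[ℂ] (l2 Γ →L[ℂ] l2 Γ) :=
  (Subalgebra.toSubmodule (VNsub Γ)).subtypeL

/-- The vector functional `ω_{f,g} : T ↦ ⟪g, T f⟫` on `VN(Γ)`. -/
def vecFunc (f g : l2 Γ) : VNt Γ →L[ℂ] ℂ :=
  (innerSL ℂ g).comp ((ContinuousLinearMap.apply ℂ (l2 Γ) f).comp (VNincl Γ))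

/-- The Fourier algebra `A(Γ)` realized as the predual of `VN(Γ)`: the norm closure of the
span of the vector functionals inside `VN(Γ)*`. -/
def APre : Submodule ℂ (VNt Γ →L[ℂ] ℂ) :=
  (Submodule.span ℂ {ω | ∃ f g : l2 Γ, ω = vecFunc Γ f g}).topologicalClosure

/-- Functionals on `VN(Γ)` vanishing at `λ(γ)` for every `γ ∉ E`. -/
def vanishOff (E : Set Γ) : Submodule ℂ (VNt Γ →L[ℂ] ℂ) where
  carrier := {ω | ∀ γ ∉ E, ω (LopVN Γ γ) = 0}
  add_mem' := by intro a b ha hb γ hγ; simp [ha γ hγ, hb γ hγ]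
  zero_mem' := by intro γ hγ; simp
  smul_mem' := by intro c a ha γ hγ; simp [ha γ hγ]

/-- The ideal `A_E(Γ)` of the Fourier algebra, realized inside `VN(Γ)*`: elements of
`A(Γ)` whose associated function `γ ↦ ω(λ(γ))` vanishes off `E`. -/
def AE (E : Set Γ) : Submodule ℂ (VNt Γ →L[ℂ] ℂ) :=
  APre Γ ⊓ vanishOff Γ E

/-- `A_E(Γ)` as a Banach space. -/
def AEt (E : Set Γ) : Type _ := ↥(AE Γ E)

instance (E : Set Γ) : NormedAddCommGroup (AEt Γ E) :=
  inferInstanceAs (NormedAddCommGroup ↥(AE Γ E))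

instance (E : Set Γ) : NormedSpace ℂ (AEt Γ E) :=
  inferInstanceAs (NormedSpace ℂ ↥(AE Γ E))

/-- A normed space is reflexive when the canonical embedding into its bidual is onto. -/
def IsReflexiveSp (X : Type*) [NormedAddCommGroup X] [NormedSpace ℂ X] : Prop :=
  Function.Surjective (NormedSpace.inclusionInDoubleDual ℂ X)

end VNSetup

theorem exists_mem_closure_convexHull_tails {X : Type*} [NormedAddCommGroup X] [NormedSpace ℂ X]
    (hX : Function.Surjective (NormedSpace.inclusionInDoubleDual ℂ X))
    (u : ℕ → X) (C : ℝ) (hu : ∀ n, ‖u n‖ ≤ C) :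
    ∃ x : X, ∀ m, x ∈ closure (convexHull ℝ (u '' Set.Ici m)) := by
  obtain ⟨U, hU⟩ : ∃ U : Ultrafilter ℕ, (U : Filter ℕ) ≤ atTop := Ultrafilter.exists_le _
  have hbdd : ∀ (φ : X →L[ℂ] ℂ) n, ‖φ (u n)‖ ≤ C * ‖φ‖ := fun φ n =>
    (φ.le_opNorm _).trans (by rw [mul_comm]; gcongr; exact hu n)
  have hlim : ∀ φ : X →L[ℂ] ℂ, ∃ z, Tendsto (fun n => φ (u n)) U (𝓝 z) := by
    intro φ
    have hK := isCompact_closedBall (0 : ℂ) (C * ‖φ‖)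
    obtain ⟨z, -, hz⟩ := hK.ultrafilter_le_nhds (U.map fun n => φ (u n))
      (by
        rw [le_principal_iff]
        exact Filter.mem_map.2 (Filter.univ_mem' fun n => by simpa using hbdd φ n))
    exact ⟨z, hz⟩
  choose L hL using hlim
  let Φ : (X →L[ℂ] ℂ) →L[ℂ] ℂ := LinearMap.mkContinuous
    { toFun := L
      map_add' := fun φ ψ => tendsto_nhds_unique (hL (φ + ψ)) ((hL φ).add (hL ψ))
      map_smul' := fun c φ => tendsto_nhds_unique (hL (c • φ)) ((hL φ).const_smul c) } C
    (fun φ => le_of_tendsto (hL φ).norm (Eventually.of_forall (hbdd φ)))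
  obtain ⟨x, hx⟩ := hX Φ
  refine ⟨x, fun m => ?_⟩
  by_contra hmem
  obtain ⟨φ, s, hs, hs'⟩ := RCLike.geometric_hahn_banach_point_closed (𝕜 := ℂ)
    (convex_convexHull ℝ (u '' Set.Ici m)).closure isClosed_closure hmem
  have hφ : φ x = L φ := by
    have := congrArg (fun F : (X →L[ℂ] ℂ) →L[ℂ] ℂ => F φ) hx
    exact this
  have h1 : Tendsto (fun n => RCLike.re (φ (u n))) U (𝓝 (RCLike.re (φ x))) := by
    rw [hφ]
    exact (RCLike.continuous_re.tendsto _).comp (hL φ)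
  have h2 : s ≤ RCLike.re (φ x) := by
    refine ge_of_tendsto h1 (hU (?_ : ∀ᶠ n in atTop, _))
    filter_upwards [eventually_ge_atTop m] with n hn
    exact (hs' _ (subset_closure (subset_convexHull ℝ _ ⟨n, hn, rfl⟩))).le
  linarith

section Hilbert

variable {H : Type*} [NormedAddCommGroup H] [InnerProductSpace ℂ H]

theorem norm_inner_le_half {w : H →L[ℂ] H} (hw : ‖w‖ ≤ 1) (x y : H) :
    ‖inner ℂ x (w y)‖ ≤ (‖x‖ ^ 2 + ‖y‖ ^ 2) / 2 := by
  have h1 : ‖w y‖ ≤ ‖y‖ :=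
    (w.le_opNorm _).trans (mul_le_of_le_one_left (norm_nonneg _) hw)
  have h2 := norm_inner_le_norm (𝕜 := ℂ) x (w y)
  nlinarith [norm_nonneg x, norm_nonneg y, sq_nonneg (‖x‖ - ‖y‖),
    mul_le_mul_of_nonneg_left h1 (norm_nonneg x)]

variable [CompleteSpace H]

/-- The products `(1 - Bₙ₋₁† Bₙ₋₁) ⋯ (1 - B₀† B₀)`. -/
noncomputable def defectProd (B : ℕ → H →L[ℂ] H) : ℕ → H →L[ℂ] H
  | 0 => 1
  | n + 1 => (1 - (B n).adjoint * B n) * defectProd B n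

/-- `∑_{i<n} xᵢ† Wᵢ xᵢ` where `xᵢ = Bᵢ (1 - Bᵢ₋₁† Bᵢ₋₁) ⋯ (1 - B₀† B₀)`. -/
noncomputable def diagSum (B W : ℕ → H →L[ℂ] H) (n : ℕ) : H →L[ℂ] H :=
  ∑ i ∈ Finset.range n,
    (B i * defectProd B i).adjoint * (W i * (B i * defectProd B i))

variable {B W : ℕ → H →L[ℂ] H}

theorem norm_sq_add_norm_defect_sq_le {b : H →L[ℂ] H} (hb : ‖b‖ ≤ 1) (v : H) :
    ‖b v‖ ^ 2 + ‖(1 - b.adjoint * b) v‖ ^ 2 ≤ ‖v‖ ^ 2 := by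
  have h1 : ‖b.adjoint (b v)‖ ≤ ‖b v‖ := by
    refine (b.adjoint.le_opNorm _).trans ?_
    rw [LinearIsometryEquiv.norm_map]
    exact mul_le_of_le_one_left (norm_nonneg _) hb
  have h2 : ‖(1 - b.adjoint * b) v‖ ^ 2
      = ‖v‖ ^ 2 - 2 * ‖b v‖ ^ 2 + ‖b.adjoint (b v)‖ ^ 2 := by
    have : (1 - b.adjoint * b) v = v - b.adjoint (b v) := by simp
    rw [this, @norm_sub_sq ℂ, ContinuousLinearMap.adjoint_inner_right, inner_self_eq_norm_sq]
  nlinarith [norm_nonneg (b.adjoint (b v)), norm_nonneg (b v)]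

theorem sum_norm_sq_add_norm_defectProd_sq_le (hB : ∀ i, ‖B i‖ ≤ 1) (n : ℕ) (v : H) :
    ∑ i ∈ Finset.range n, ‖B i (defectProd B i v)‖ ^ 2 + ‖defectProd B n v‖ ^ 2 ≤ ‖v‖ ^ 2 := by
  induction n with
  | zero => simp [defectProd]
  | succ n ih =>
    rw [Finset.sum_range_succ]
    have := norm_sq_add_norm_defect_sq_le (hB n) (defectProd B n v)
    simp only [defectProd, mul_apply_eq_comp] at *
    linarith

theorem norm_defectProd_sub_le (hB : ∀ i, ‖B i‖ ≤ 1) (n : ℕ) (v : H) :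
    ‖defectProd B n v - v‖ ≤ ∑ i ∈ Finset.range n, ‖B i v‖ := by
  induction n with
  | zero => simp [defectProd]
  | succ n ih =>
    rw [Finset.sum_range_succ]
    have h1 : ‖(1 - (B n).adjoint * B n) (defectProd B n v - v)‖ ≤ ‖defectProd B n v - v‖ := by
      refine le_of_sq_le_sq ?_ (norm_nonneg _)
      have := norm_sq_add_norm_defect_sq_le (hB n) (defectProd B n v - v)
      nlinarith [sq_nonneg ‖B n (defectProd B n v - v)‖]
    have h2 : ‖(B n).adjoint (B n v)‖ ≤ ‖B n v‖ := by
      refine ((B n).adjoint.le_opNorm _).trans ?_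
      rw [LinearIsometryEquiv.norm_map]
      exact mul_le_of_le_one_left (norm_nonneg _) (hB n)
    have h3 : defectProd B (n + 1) v - v
        = (1 - (B n).adjoint * B n) (defectProd B n v - v) - (B n).adjoint (B n v) := by
      simp [defectProd]
      abel
    rw [h3]
    exact (norm_sub_le _ _).trans (by linarith)

theorem inner_diagSum (n : ℕ) (f g : H) :
    inner ℂ g (diagSum B W n f) = ∑ i ∈ Finset.range n,
      inner ℂ (B i (defectProd B i g)) (W i (B i (defectProd B i f))) := by
  simp only [diagSum, sum_apply, inner_sum, mul_apply_eq_comp]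
  refine Finset.sum_congr rfl fun i _ => ?_
  rw [ContinuousLinearMap.adjoint_inner_right, mul_apply_eq_comp]

theorem norm_inner_diagSum_le (hW : ∀ i, ‖W i‖ ≤ 1) (n : ℕ) (f g : H) :
    ‖inner ℂ g (diagSum B W n f)‖ ≤
      (∑ i ∈ Finset.range n, ‖B i (defectProd B i g)‖ ^ 2
        + ∑ i ∈ Finset.range n, ‖B i (defectProd B i f)‖ ^ 2) / 2 := by
  rw [inner_diagSum, ← Finset.sum_add_distrib, Finset.sum_div]
  exact (norm_sum_le _ _).trans (Finset.sum_le_sum fun i _ => norm_inner_le_half (hW i) _ _)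

theorem norm_diagSum_le_one (hB : ∀ i, ‖B i‖ ≤ 1) (hW : ∀ i, ‖W i‖ ≤ 1) (n : ℕ) :
    ‖diagSum B W n‖ ≤ 1 := by
  refine ContinuousLinearMap.opNorm_le_of_unit_norm zero_le_one fun f hf => ?_
  rcases eq_or_ne (diagSum B W n f) 0 with h0 | h0
  · simp [h0]
  set g : H := ((‖diagSum B W n f‖⁻¹ : ℝ) : ℂ) • diagSum B W n f with hg
  have hn : ‖diagSum B W n f‖ ≠ 0 := norm_ne_zero_iff.2 h0
  have hg1 : ‖g‖ = 1 := by rw [hg, norm_smul]; simp [hn]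
  have h1 : ‖inner ℂ g (diagSum B W n f)‖ = ‖diagSum B W n f‖ := by
    rw [hg, inner_smul_left, inner_self_eq_norm_sq_to_K]
    simp
    field_simp
  have h2 := norm_inner_diagSum_le (B := B) hW n f g
  have h3 := sum_norm_sq_add_norm_defectProd_sq_le hB n f
  have h4 := sum_norm_sq_add_norm_defectProd_sq_le hB n g
  rw [h1] at h2
  rw [hf] at h3
  rw [hg1] at h4
  nlinarith [sq_nonneg ‖defectProd B n f‖, sq_nonneg ‖defectProd B n g‖]

theorem norm_inner_diagSum_le_of_defectProd (hB : ∀ i, ‖B i‖ ≤ 1) (hW : ∀ i, ‖W i‖ ≤ 1)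
    (n : ℕ) (f g : H) :
    ‖inner ℂ g (diagSum B W n f)‖ ≤
      ‖g‖ * ‖defectProd B n g - g‖ + ‖f‖ * ‖defectProd B n f - f‖ := by
  have key : ∀ v : H, ∑ i ∈ Finset.range n, ‖B i (defectProd B i v)‖ ^ 2
      ≤ 2 * (‖v‖ * ‖defectProd B n v - v‖) := by
    intro v
    have h1 := sum_norm_sq_add_norm_defectProd_sq_le hB n v
    have h2 : ‖v‖ ≤ ‖defectProd B n v‖ + ‖defectProd B n v - v‖ := by
      rw [norm_sub_rev]; exact norm_le_norm_add_norm_sub' v (defectProd B n v)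
    have h3 : ‖defectProd B n v‖ ≤ ‖v‖ := le_of_sq_le_sq (by
      have : 0 ≤ ∑ i ∈ Finset.range n, ‖B i (defectProd B i v)‖ ^ 2 := by positivity
      linarith) (norm_nonneg _)
    nlinarith [norm_nonneg v, norm_nonneg (defectProd B n v)]
  have := norm_inner_diagSum_le (B := B) hW n f g
  have := key f
  have := key g
  linarith

theorem half_le_re_inner_diagSum (hB : ∀ i, ‖B i‖ ≤ 1) (hW : ∀ i, ‖W i‖ ≤ 1)
    {n i : ℕ} (hi : i < n) {f g : H} (hf : ‖f‖ = 1) (hg : ‖g‖ = 1) (hgf : W i f = g)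
    (hxf : ‖B i (defectProd B i f) - f‖ ≤ 1 / 8)
    (hxg : ‖B i (defectProd B i g) - g‖ ≤ 1 / 8) :
    1 / 2 ≤ (inner ℂ g (diagSum B W n f)).re := by
  set xf := B i (defectProd B i f)
  set xg := B i (defectProd B i g)
  have hmem : i ∈ Finset.range n := Finset.mem_range.2 hi
  have hsq : ∀ v : H, ‖v‖ = 1 → ‖B i (defectProd B i v) - v‖ ≤ 1 / 8 →
      ∑ j ∈ (Finset.range n).erase i, ‖B j (defectProd B j v)‖ ^ 2 ≤ 1 / 4 ∧
      ‖B i (defectProd B i v)‖ ≤ 1 := by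
    intro v hv hxv
    have h1 := sum_norm_sq_add_norm_defectProd_sq_le hB n v
    rw [← Finset.add_sum_erase _ _ hmem, hv] at h1
    have h2 : 7 / 8 ≤ ‖B i (defectProd B i v)‖ := by
      have := norm_le_norm_add_norm_sub' v (B i (defectProd B i v))
      rw [norm_sub_rev, hv] at this
      linarith
    have h3 : 0 ≤ ∑ j ∈ (Finset.range n).erase i, ‖B j (defectProd B j v)‖ ^ 2 := by positivity
    constructor <;> nlinarith [sq_nonneg ‖defectProd B n v‖]
  obtain ⟨hf1, hf2⟩ := hsq f hf hxf
  obtain ⟨hg1, hg2⟩ := hsq g hg hxg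
  have hrest : ‖∑ j ∈ (Finset.range n).erase i,
      inner ℂ (B j (defectProd B j g)) (W j (B j (defectProd B j f)))‖ ≤ 1 / 4 := by
    refine (norm_sum_le _ _).trans ((Finset.sum_le_sum
      fun j _ => norm_inner_le_half (hW j) _ _).trans ?_)
    rw [← Finset.sum_div, Finset.sum_add_distrib]
    linarith
  have hmain : ‖inner ℂ xg (W i xf) - 1‖ ≤ 1 / 4 := by
    have h1 : inner ℂ xg (W i xf) - 1 = inner ℂ xg (W i (xf - f)) + inner ℂ (xg - g) (W i f) := by
      have : inner ℂ g g = 1 := by rw [inner_self_eq_norm_sq_to_K, hg]; simp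
      rw [map_sub, inner_sub_right, inner_sub_left, hgf, this]
      ring
    have hWle : ∀ v, ‖W i v‖ ≤ ‖v‖ := fun v =>
      ((W i).le_opNorm _).trans (mul_le_of_le_one_left (norm_nonneg _) (hW i))
    rw [h1]
    refine (norm_add_le _ _).trans ?_
    have h2 := norm_inner_le_norm (𝕜 := ℂ) xg (W i (xf - f))
    have h3 := norm_inner_le_norm (𝕜 := ℂ) (xg - g) (W i f)
    have h4 := hWle (xf - f)
    rw [hgf, hg] at h3
    rw [hgf]
    nlinarith [norm_nonneg xg, norm_nonneg (W i (xf - f))]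
  rw [inner_diagSum, ← Finset.add_sum_erase _ _ hmem, Complex.add_re]
  have h1 := (Complex.abs_re_le_norm _).trans hrest
  have h2 := (Complex.abs_re_le_norm _).trans hmain
  rw [abs_le] at h1 h2
  simp only [Complex.sub_re, Complex.one_re] at h2
  linarith [h1.1, h2.1]

end Hilbert

section Translations

variable {Γ : Type*}

/-- The standard unit vector of `ℓ²(Γ)` at `γ`. -/
def basisVec (γ : Γ) : l2 Γ :=
  haveI := Classical.decEq Γ
  lp.single 2 γ (1 : ℂ)

theorem basisVec_apply (γ x : Γ) [Decidable (x = γ)] :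
    (basisVec γ : l2 Γ) x = if x = γ then 1 else 0 := by
  classical
  simp only [basisVec, lp.coeFn_single, Pi.single_apply]
  congr

theorem orthonormal_basisVec : Orthonormal ℂ (basisVec : Γ → l2 Γ) := by
  classical
  rw [orthonormal_iff_ite]
  intro x y
  have : (basisVec x : l2 Γ) = lp.single 2 x (1 : ℂ) := by
    simp only [basisVec]
  rw [this, lp.inner_single_left, basisVec_apply]
  simp

variable [Group Γ]

theorem Lop_apply (γ : Γ) (f : l2 Γ) (x : Γ) : Lop Γ γ f x = f (γ⁻¹ * x) := rfl

theorem norm_Lop_apply (γ : Γ) (f : l2 Γ) : ‖Lop Γ γ f‖ = ‖f‖ := (transIso Γ γ).norm_map f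

theorem norm_Lop_le_one (γ : Γ) : ‖Lop Γ γ‖ ≤ 1 :=
  ContinuousLinearMap.opNorm_le_bound _ zero_le_one fun f => by rw [norm_Lop_apply, one_mul]

theorem Lop_basisVec (γ x : Γ) : Lop Γ γ (basisVec x) = basisVec (γ * x) := by
  classical
  ext y
  rw [Lop_apply, basisVec_apply, basisVec_apply]
  simp only [inv_mul_eq_iff_eq_mul]

theorem adjoint_Lop (γ : Γ) : (Lop Γ γ).adjoint = Lop Γ γ⁻¹ := by
  symm
  rw [ContinuousLinearMap.eq_adjoint_iff]
  intro f g
  have h : Lop Γ γ (Lop Γ γ⁻¹ f) = f := by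
    ext x
    simp [Lop_apply]
  conv_rhs => rw [← h]
  exact ((transIso Γ γ).inner_map_map _ _).symm

theorem Lop_mem_VNsub (γ : Γ) : Lop Γ γ ∈ VNsub Γ := (LopVN Γ γ).2

theorem adjoint_mem_VNsub {T : l2 Γ →L[ℂ] l2 Γ} (hT : T ∈ VNsub Γ) :
    T.adjoint ∈ VNsub Γ := by
  rw [VNsub, Subalgebra.mem_centralizer_iff] at hT ⊢
  intro S hS
  have hS' : S.adjoint ∈ Subalgebra.centralizer ℂ (Set.range (Lop Γ)) := by
    rw [Subalgebra.mem_centralizer_iff]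
    rintro _ ⟨γ, rfl⟩
    have h := (Subalgebra.mem_centralizer_iff ℂ).1 hS (Lop Γ γ⁻¹) ⟨_, rfl⟩
    have h' := congrArg star h
    simpa only [star_mul, ContinuousLinearMap.star_eq_adjoint, adjoint_Lop, inv_inv]
      using h'.symm
  have h := congrArg star (hT _ hS')
  simpa only [star_mul, ContinuousLinearMap.star_eq_adjoint,
    ContinuousLinearMap.adjoint_adjoint] using h.symm

theorem defectProd_mem_VNsub {B : ℕ → l2 Γ →L[ℂ] l2 Γ} (hB : ∀ i, B i ∈ VNsub Γ) (n : ℕ) :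
    defectProd B n ∈ VNsub Γ := by
  induction n with
  | zero => exact one_mem _
  | succ n ih =>
    exact mul_mem (sub_mem (one_mem _) (mul_mem (adjoint_mem_VNsub (hB n)) (hB n))) ih

theorem diagSum_mem_VNsub {B W : ℕ → l2 Γ →L[ℂ] l2 Γ} (hB : ∀ i, B i ∈ VNsub Γ)
    (hW : ∀ i, W i ∈ VNsub Γ) (n : ℕ) : diagSum B W n ∈ VNsub Γ :=
  sum_mem fun i _ =>
    have hx := mul_mem (hB i) (defectProd_mem_VNsub hB i)
    mul_mem (adjoint_mem_VNsub hx) (mul_mem (hW i) hx)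

theorem norm_vecFunc_le (f g : l2 Γ) : ‖vecFunc Γ f g‖ ≤ ‖g‖ * ‖f‖ := by
  refine ContinuousLinearMap.opNorm_le_bound _ (by positivity) fun T => ?_
  have h1 : ‖vecFunc Γ f g T‖ ≤ ‖g‖ * ‖VNincl Γ T f‖ :=
    norm_inner_le_norm (𝕜 := ℂ) g (VNincl Γ T f)
  have h2 : ‖VNincl Γ T f‖ ≤ ‖T‖ * ‖f‖ := (VNincl Γ T).le_opNorm f
  calc _ ≤ ‖g‖ * (‖T‖ * ‖f‖) := h1.trans (by gcongr)
    _ = _ := by ring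

/-- The sum of the unit vectors at `ψ ^ i * γ` for `i < n`. -/
def powSum (ψ γ : Γ) (n : ℕ) : l2 Γ := ∑ i ∈ Finset.range n, basisVec (ψ ^ i * γ)

theorem norm_powSum {ψ : Γ} {n : ℕ} (hψ : Set.InjOn (fun i : ℕ => ψ ^ i) (Set.Iio n)) (γ : Γ) :
    ‖powSum ψ γ n‖ = √n := by
  classical
  have hinj : Set.InjOn (fun i : ℕ => ψ ^ i * γ) (Finset.range n) := by
    intro i hi j hj hij
    exact hψ (by simpa using hi) (by simpa using hj) (mul_right_cancel hij)
  have h1 : powSum ψ γ n = ∑ x ∈ (Finset.range n).image (fun i : ℕ => ψ ^ i * γ),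
      (1 : ℂ) • basisVec x := by
    rw [Finset.sum_image hinj]
    simp [powSum]
  have h2 : ‖powSum ψ γ n‖ ^ 2 = n := by
    have : ((‖powSum ψ γ n‖ ^ 2 : ℝ) : ℂ) = ((n : ℝ) : ℂ) := by
      push_cast
      rw [← Complex.coe_algebraMap, ← inner_self_eq_norm_sq_to_K (𝕜 := ℂ), h1,
        orthonormal_basisVec.inner_sum]
      simp [Finset.card_image_of_injOn hinj]
    exact_mod_cast this
  rw [← h2, Real.sqrt_sq (norm_nonneg _)]

theorem Lop_pow_powSum (ψ γ : Γ) (i n : ℕ) :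
    Lop Γ (ψ ^ i) (powSum ψ γ n) = powSum ψ (ψ ^ i * γ) n := by
  simp only [powSum, map_sum, Lop_basisVec, ← mul_assoc, ← pow_add, add_comm]

theorem powSum_add (ψ γ : Γ) (m n : ℕ) :
    powSum ψ γ (m + n) = powSum ψ γ m + powSum ψ (ψ ^ m * γ) n := by
  simp only [powSum, Finset.sum_range_add, ← mul_assoc, ← pow_add, add_comm]

theorem norm_Lop_pow_powSum_sub_le {ψ : Γ} {n i : ℕ}
    (hψ : Set.InjOn (fun i : ℕ => ψ ^ i) (Set.Iio i)) (γ : Γ) :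
    ‖Lop Γ (ψ ^ i) (powSum ψ γ n) - powSum ψ γ n‖ ≤ 2 * √i := by
  have h : Lop Γ (ψ ^ i) (powSum ψ γ n) - powSum ψ γ n
      = powSum ψ (ψ ^ n * γ) i - powSum ψ γ i := by
    rw [Lop_pow_powSum, sub_eq_sub_iff_add_eq_add, add_comm, ← powSum_add, add_comm i n,
      powSum_add, add_comm]
  rw [h]
  refine (norm_sub_le _ _).trans ?_
  rw [norm_powSum hψ, norm_powSum hψ]
  linarith

/-- The average of the translations by `ψ ^ i` for `i < n`. -/
def avgOp (ψ : Γ) (n : ℕ) : l2 Γ →L[ℂ] l2 Γ :=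
  ((n : ℂ)⁻¹) • ∑ i ∈ Finset.range n, Lop Γ (ψ ^ i)

theorem avgOp_mem_VNsub (ψ : Γ) (n : ℕ) : avgOp ψ n ∈ VNsub Γ :=
  Subalgebra.smul_mem _ (sum_mem fun _ _ => Lop_mem_VNsub _) _

theorem norm_avgOp_le_one (ψ : Γ) (n : ℕ) : ‖avgOp ψ n‖ ≤ 1 := by
  rw [avgOp, norm_smul]
  have h : ‖∑ i ∈ Finset.range n, Lop Γ (ψ ^ i)‖ ≤ n := by
    refine (norm_sum_le _ _).trans ((Finset.sum_le_sum fun i _ => norm_Lop_le_one _).trans ?_)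
    simp
  calc _ ≤ ‖(n : ℂ)⁻¹‖ * n := by gcongr
    _ ≤ 1 := by simpa using inv_mul_le_one

theorem norm_avgOp_basisVec {ψ : Γ} {s : ℕ} (hs : 0 < s)
    (hψ : Set.InjOn (fun i : ℕ => ψ ^ i) (Set.Iio (s ^ 2))) (γ : Γ) :
    ‖avgOp ψ (s ^ 2) (basisVec γ)‖ = (s : ℝ)⁻¹ := by
  have h : avgOp ψ (s ^ 2) (basisVec γ) = (((s ^ 2 : ℕ) : ℂ)⁻¹) • powSum ψ γ (s ^ 2) := by
    simp [avgOp, powSum, Lop_basisVec]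
  rw [h, norm_smul, norm_powSum hψ]
  have : (0 : ℝ) < s := by exact_mod_cast hs
  simp [Real.sqrt_sq this.le]
  field_simp

theorem norm_avgOp_powSum_le {ψ φ : Γ} {s n : ℕ} (hs : 0 < s)
    (hψ : Set.InjOn (fun i : ℕ => ψ ^ i) (Set.Iio (s ^ 2))) (γ : Γ) :
    ‖avgOp ψ (s ^ 2) (powSum φ γ n)‖ ≤ n * (s : ℝ)⁻¹ := by
  rw [powSum, map_sum]
  refine (norm_sum_le _ _).trans (le_of_eq ?_)
  simp [norm_avgOp_basisVec hs hψ]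

theorem norm_avgOp_powSum_sub_le {ψ : Γ} {s n : ℕ} (hs : 0 < s)
    (hψ : Set.InjOn (fun i : ℕ => ψ ^ i) (Set.Iio (s ^ 2))) (γ : Γ) :
    ‖avgOp ψ (s ^ 2) (powSum ψ γ n) - powSum ψ γ n‖ ≤ 2 * s := by
  have hs' : (0 : ℝ) < s := by exact_mod_cast hs
  have h : avgOp ψ (s ^ 2) (powSum ψ γ n) - powSum ψ γ n = (((s ^ 2 : ℕ) : ℂ)⁻¹) •
      ∑ i ∈ Finset.range (s ^ 2), (Lop Γ (ψ ^ i) (powSum ψ γ n) - powSum ψ γ n) := by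
    have hc : ((s ^ 2 : ℕ) : ℂ) ≠ 0 := by exact_mod_cast (pow_pos hs 2).ne'
    rw [Finset.sum_sub_distrib, smul_sub, Finset.sum_const, Finset.card_range,
      ← Nat.cast_smul_eq_nsmul ℂ, inv_smul_smul₀ hc]
    simp [avgOp]
  have hi : ∀ i ∈ Finset.range (s ^ 2),
      ‖Lop Γ (ψ ^ i) (powSum ψ γ n) - powSum ψ γ n‖ ≤ 2 * s := by
    intro i hi
    have hi' := Finset.mem_range.1 hi
    refine (norm_Lop_pow_powSum_sub_le (hψ.mono (Set.Iio_subset_Iio hi'.le)) γ).trans ?_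
    have : √(i : ℝ) ≤ s := Real.sqrt_le_iff.2 ⟨hs'.le, by exact_mod_cast hi'.le⟩
    linarith
  rw [h, norm_smul]
  have h2 := (norm_sum_le _ _).trans (Finset.sum_le_sum hi)
  simp only [Finset.sum_const, Finset.card_range, nsmul_eq_mul] at h2
  calc _ ≤ ‖(((s ^ 2 : ℕ) : ℂ)⁻¹)‖ * (((s ^ 2 : ℕ) : ℝ) * (2 * s)) := by gcongr
    _ = 2 * s := by
      simp
      field_simp

/-- The normalized sum `r⁻¹ ∑_{i < r²} δ_{ψ ^ i γ}`, of norm one if the powers are distinct. -/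
def unitVec (ψ γ : Γ) (r : ℕ) : l2 Γ := ((r : ℂ)⁻¹) • powSum ψ γ (r ^ 2)

theorem norm_unitVec {ψ : Γ} {r : ℕ} (hr : 0 < r)
    (hψ : Set.InjOn (fun i : ℕ => ψ ^ i) (Set.Iio (r ^ 2))) (γ : Γ) :
    ‖unitVec ψ γ r‖ = 1 := by
  have hr' : (0 : ℝ) < r := by exact_mod_cast hr
  rw [unitVec, norm_smul, norm_powSum hψ]
  simp [Real.sqrt_sq hr'.le, hr'.ne']

theorem norm_avgOp_unitVec_le {ψ φ : Γ} {s r : ℕ} (hs : 0 < s) (hr : 0 < r)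
    (hψ : Set.InjOn (fun i : ℕ => ψ ^ i) (Set.Iio (s ^ 2))) (γ : Γ) :
    ‖avgOp ψ (s ^ 2) (unitVec φ γ r)‖ ≤ r / s := by
  have hr' : (0 : ℝ) < r := by exact_mod_cast hr
  have h := norm_avgOp_powSum_le (φ := φ) (n := r ^ 2) hs hψ γ
  rw [unitVec, map_smul, norm_smul]
  calc _ ≤ ‖((r : ℂ)⁻¹)‖ * (((r ^ 2 : ℕ) : ℝ) * (s : ℝ)⁻¹) := by gcongr
    _ = r / s := by
      simp
      field_simp

theorem norm_avgOp_unitVec_sub_le {ψ : Γ} {s r : ℕ} (hs : 0 < s)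
    (hψ : Set.InjOn (fun i : ℕ => ψ ^ i) (Set.Iio (s ^ 2))) (γ : Γ) :
    ‖avgOp ψ (s ^ 2) (unitVec ψ γ r) - unitVec ψ γ r‖ ≤ 2 * s / r := by
  have h := norm_avgOp_powSum_sub_le (n := r ^ 2) hs hψ γ
  rw [unitVec, map_smul, ← smul_sub, norm_smul]
  calc _ ≤ ‖((r : ℂ)⁻¹)‖ * (2 * s) := by gcongr
    _ = 2 * s / r := by
      simp
      field_simp

theorem Lop_pow_unitVec (ψ : Γ) (i r : ℕ) :
    Lop Γ (ψ ^ i) (unitVec ψ 1 r) = unitVec ψ (ψ ^ i) r := by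
  rw [unitVec, map_smul, Lop_pow_powSum, mul_one, unitVec]

theorem vecFunc_unitVec_eq_zero {ψ γ : Γ} {r : ℕ}
    (hγ : ∀ j : ℕ, 1 ≤ j → j ≤ 2 * r ^ 2 → γ ≠ ψ ^ j) :
    vecFunc Γ (unitVec ψ 1 r) (unitVec ψ (ψ ^ r ^ 2) r) (LopVN Γ γ) = 0 := by
  classical
  have h : inner ℂ (powSum ψ (ψ ^ r ^ 2) (r ^ 2)) (Lop Γ γ (powSum ψ 1 (r ^ 2))) = 0 := by
    simp only [powSum, map_sum, Lop_basisVec, sum_inner, inner_sum]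
    refine Finset.sum_eq_zero fun i hi => Finset.sum_eq_zero fun j hj => ?_
    rw [orthonormal_iff_ite.1 orthonormal_basisVec, if_neg]
    intro hij
    simp only [Finset.mem_range] at hi hj
    have hle : i ≤ j + r ^ 2 := by omega
    refine hγ (j + r ^ 2 - i) (by omega) (by omega) ?_
    rw [pow_sub _ hle, pow_add, eq_mul_inv_iff_mul_eq]
    simpa using hij.symm
  change inner ℂ (unitVec ψ (ψ ^ r ^ 2) r) (Lop Γ γ (unitVec ψ 1 r)) = 0
  rw [unitVec, unitVec, map_smul, inner_smul_left, inner_smul_right, h]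
  simp

end Translations

section Limits

/-- The vectors sent to a null sequence by a sequence of linear maps. -/
def tendstoZeroSubmodule {E F : Type*} [NormedAddCommGroup E] [NormedSpace ℂ E] [NormedAddCommGroup F]
    [NormedSpace ℂ F] (A : ℕ → E →L[ℂ] F) : Submodule ℂ E where
  carrier := {v | Tendsto (fun n => A n v) atTop (𝓝 0)}
  add_mem' := by
    intro a b ha hb
    simpa using Tendsto.add ha hb
  zero_mem' := by simp
  smul_mem' := by
    intro c a ha
    simpa using Tendsto.const_smul ha c

theorem isClosed_tendstoZeroSubmodule {E F : Type*} [NormedAddCommGroup E] [NormedSpace ℂ E]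
    [NormedAddCommGroup F] [NormedSpace ℂ F] (A : ℕ → E →L[ℂ] F) {C : ℝ}
    (hA : ∀ n, ‖A n‖ ≤ C) : IsClosed (tendstoZeroSubmodule A : Set E) := by
  refine isClosed_of_closure_subset fun v hv => ?_
  have hC : 0 ≤ C := (norm_nonneg _).trans (hA 0)
  refine Metric.tendsto_atTop.2 fun ε hε => ?_
  obtain ⟨w, hw, hvw⟩ := Metric.mem_closure_iff.1 hv (ε / (2 * (C + 1))) (by positivity)
  obtain ⟨n₀, hn₀⟩ := Metric.tendsto_atTop.1 hw (ε / 2) (by positivity)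
  refine ⟨n₀, fun n hn => ?_⟩
  have h1 := hn₀ n hn
  rw [dist_zero_right] at h1 ⊢
  rw [dist_eq_norm] at hvw
  have h2 : ‖A n (v - w)‖ ≤ C * (ε / (2 * (C + 1))) :=
    ((A n).le_opNorm _).trans (by gcongr; exact hA n)
  have h3 : C * (ε / (2 * (C + 1))) ≤ ε / 2 := by
    rw [mul_div_assoc', div_le_div_iff₀ (by positivity) (by positivity)]
    nlinarith
  have h4 : A n v = A n (v - w) + A n w := by simp
  rw [h4]
  exact (norm_add_le _ _).trans_lt (by linarith)

variable {Γ : Type*}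

theorem mem_of_forall_basisVec_mem {V : Submodule ℂ (l2 Γ)} (hV : IsClosed (V : Set (l2 Γ)))
    (h : ∀ γ, basisVec γ ∈ V) (v : l2 Γ) : v ∈ V := by
  classical
  have hs := lp.hasSum_single (p := 2) (by norm_num) v
  refine hV.mem_of_tendsto hs (Eventually.of_forall fun s => ?_)
  refine V.sum_mem fun γ _ => ?_
  have : (lp.single 2 γ (v γ) : l2 Γ) = v γ • basisVec γ := by
    ext x
    simp only [lp.coeFn_smul, Pi.smul_apply, basisVec_apply, lp.coeFn_single, Pi.single_apply]
    split_ifs with hx <;> simp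
  rw [this]
  exact V.smul_mem _ (h γ)

end Limits

section Construction

variable {Γ : Type*} [Group Γ]

/-- The averaging operators of lengths `(1024 ^ j) ^ 2`, listed downwards from index
`m + L - 1`. -/
def revAvg (ψ : ℕ → Γ) (m L i : ℕ) : l2 Γ →L[ℂ] l2 Γ :=
  avgOp (ψ (m + L - 1 - i)) ((1024 ^ (m + L - 1 - i)) ^ 2)

/-- The translations by `ψ j ^ (32 * 1024 ^ j) ^ 2`, listed downwards from index `m + L - 1`. -/
def revTrans (ψ : ℕ → Γ) (m L i : ℕ) : l2 Γ →L[ℂ] l2 Γ :=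
  Lop Γ (ψ (m + L - 1 - i) ^ (32 * 1024 ^ (m + L - 1 - i)) ^ 2)

/-- The contraction in `VN(Γ)` norming the functionals of index in `[m, m + L)`. -/
def normingOp (ψ : ℕ → Γ) (m L : ℕ) : VNt Γ :=
  ⟨diagSum (revAvg ψ m L) (revTrans ψ m L) L,
    diagSum_mem_VNsub (fun _ => avgOp_mem_VNsub _ _) (fun _ => Lop_mem_VNsub _) L⟩

theorem norm_revAvg_le_one (ψ : ℕ → Γ) (m L i : ℕ) : ‖revAvg ψ m L i‖ ≤ 1 :=
  norm_avgOp_le_one _ _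

theorem norm_revTrans_le_one (ψ : ℕ → Γ) (m L i : ℕ) : ‖revTrans ψ m L i‖ ≤ 1 :=
  norm_Lop_le_one _

theorem norm_normingOp_le_one (ψ : ℕ → Γ) (m L : ℕ) : ‖normingOp ψ m L‖ ≤ 1 :=
  norm_diagSum_le_one (norm_revAvg_le_one ψ m L) (norm_revTrans_le_one ψ m L) L

theorem vecFunc_normingOp (ψ : ℕ → Γ) (m L : ℕ) (f g : l2 Γ) :
    vecFunc Γ f g (normingOp ψ m L)
      = inner ℂ g (diagSum (revAvg ψ m L) (revTrans ψ m L) L f) := rfl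

/-- The powers of each `ψ j` with exponent below `(32 * 1024 ^ j) ^ 2` are distinct. -/
def HasLongOrbits (ψ : ℕ → Γ) : Prop :=
  ∀ j, Set.InjOn (fun i : ℕ => ψ j ^ i) (Set.Iio ((32 * 1024 ^ j) ^ 2))

variable {ψ : ℕ → Γ}

theorem HasLongOrbits.injOn (hψ : HasLongOrbits ψ) (j : ℕ) :
    Set.InjOn (fun i : ℕ => ψ j ^ i) (Set.Iio ((1024 ^ j) ^ 2)) :=
  (hψ j).mono (Set.Iio_subset_Iio (by gcongr; omega))

theorem sum_geometric_le (n : ℕ) :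
    ∑ i ∈ Finset.range n, (1 / 1024 : ℝ) ^ (i + 1) ≤ 1 / 512 := by
  have h : ∑ i ∈ Finset.range n, (1 / 1024 : ℝ) ^ (i + 1)
      ≤ 1 / 512 - 1 / 512 * (1 / 1024) ^ n := by
    induction n with
    | zero => simp
    | succ n ih =>
      rw [Finset.sum_range_succ, pow_succ]
      have : (0 : ℝ) ≤ (1 / 1024) ^ n := by positivity
      linarith
  have : (0 : ℝ) ≤ (1 / 1024) ^ n := by positivity
  linarith

theorem norm_revAvg_defectProd_unitVec_sub_le (hψ : HasLongOrbits ψ) (m L i : ℕ)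
    (hi : i < L) (γ : Γ) :
    ‖revAvg ψ m L i (defectProd (revAvg ψ m L) i
        (unitVec (ψ (m + L - 1 - i)) γ (32 * 1024 ^ (m + L - 1 - i))))
      - unitVec (ψ (m + L - 1 - i)) γ (32 * 1024 ^ (m + L - 1 - i))‖ ≤ 1 / 8 := by
  set k := m + L - 1 - i with hk
  set v := unitVec (ψ k) γ (32 * 1024 ^ k)
  have h1 : ‖defectProd (revAvg ψ m L) i v - v‖ ≤ 1 / 16 := by
    refine (norm_defectProd_sub_le (norm_revAvg_le_one ψ m L) i v).trans ?_
    have hterm : ∀ j ∈ Finset.range i,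
        ‖revAvg ψ m L j v‖ ≤ 32 * (1 / 1024 : ℝ) ^ (i - 1 - j + 1) := by
      intro j hj
      have hj' := Finset.mem_range.1 hj
      have he : m + L - 1 - j = k + (i - 1 - j + 1) := by omega
      refine (norm_avgOp_unitVec_le (by positivity) (by positivity) (hψ.injOn _) γ).trans ?_
      rw [he]
      push_cast
      rw [pow_add, one_div_pow]
      apply le_of_eq
      field_simp
    refine (Finset.sum_le_sum hterm).trans ?_
    rw [Finset.sum_range_reflect (fun t => 32 * (1 / 1024 : ℝ) ^ (t + 1)) i, ← Finset.mul_sum]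
    linarith [sum_geometric_le i]
  have h2 : ‖revAvg ψ m L i v - v‖ ≤ 1 / 16 := by
    refine (norm_avgOp_unitVec_sub_le (by positivity) (hψ.injOn k) γ).trans (le_of_eq ?_)
    push_cast
    field_simp
    norm_num
  have h3 : ‖revAvg ψ m L i (defectProd (revAvg ψ m L) i v - v)‖ ≤ 1 / 16 :=
    (ContinuousLinearMap.le_of_opNorm_le _ (norm_revAvg_le_one ψ m L i) _).trans (by linarith)
  have h4 : revAvg ψ m L i (defectProd (revAvg ψ m L) i v) - v
      = revAvg ψ m L i (defectProd (revAvg ψ m L) i v - v) + (revAvg ψ m L i v - v) := by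
    rw [map_sub]; abel
  rw [h4]
  exact (norm_add_le _ _).trans (by linarith)

/-- The vector functional of index `k`, supported on the powers `ψ k ^ j` with
`1 ≤ j ≤ 2 * (32 * 1024 ^ k) ^ 2`. -/
def progFunc (ψ : ℕ → Γ) (k : ℕ) : VNt Γ →L[ℂ] ℂ :=
  vecFunc Γ (unitVec (ψ k) 1 (32 * 1024 ^ k))
    (unitVec (ψ k) (ψ k ^ (32 * 1024 ^ k) ^ 2) (32 * 1024 ^ k))

theorem norm_progFunc_le_one (hψ : HasLongOrbits ψ) (k : ℕ) : ‖progFunc ψ k‖ ≤ 1 := by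
  refine (norm_vecFunc_le _ _).trans ?_
  rw [norm_unitVec (by positivity) (hψ k), norm_unitVec (by positivity) (hψ k), one_mul]

theorem half_le_re_progFunc_normingOp (hψ : HasLongOrbits ψ) {m L k : ℕ} (hmk : m ≤ k)
    (hkL : k < m + L) : 1 / 2 ≤ (progFunc ψ k (normingOp ψ m L)).re := by
  obtain ⟨i, hi, rfl⟩ : ∃ i < L, m + L - 1 - i = k := ⟨m + L - 1 - k, by omega, by omega⟩
  rw [progFunc, vecFunc_normingOp]
  exact half_le_re_inner_diagSum (norm_revAvg_le_one ψ m L) (norm_revTrans_le_one ψ m L) hi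
    (norm_unitVec (by positivity) (hψ _) _) (norm_unitVec (by positivity) (hψ _) _)
    (Lop_pow_unitVec _ _ _) (norm_revAvg_defectProd_unitVec_sub_le hψ m L i hi _)
    (norm_revAvg_defectProd_unitVec_sub_le hψ m L i hi _)

theorem tendsto_defectProd_sub (hψ : HasLongOrbits ψ) (L : ℕ → ℕ) (v : l2 Γ) :
    Tendsto (fun m => defectProd (revAvg ψ m (L m)) (L m) v - v) atTop (𝓝 0) := by
  let A : ℕ → l2 Γ →L[ℂ] l2 Γ := fun m => defectProd (revAvg ψ m (L m)) (L m) - 1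
  have hA : ∀ m, ‖A m‖ ≤ 2 := by
    intro m
    refine ContinuousLinearMap.opNorm_le_bound _ zero_le_two fun w => ?_
    have h1 : ‖defectProd (revAvg ψ m (L m)) (L m) w‖ ≤ ‖w‖ := by
      refine le_of_sq_le_sq ?_ (norm_nonneg _)
      refine le_trans ?_
        (sum_norm_sq_add_norm_defectProd_sq_le (norm_revAvg_le_one ψ m (L m)) (L m) w)
      exact le_add_of_nonneg_left (by positivity)
    have h2 : A m w = defectProd (revAvg ψ m (L m)) (L m) w - w := rfl
    rw [h2]
    exact (norm_sub_le _ _).trans (by linarith)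
  refine mem_of_forall_basisVec_mem (isClosed_tendstoZeroSubmodule A hA) (fun γ => ?_) v
  refine squeeze_zero_norm (a := fun m => (1 / 1024 : ℝ) ^ m * 2) (fun m => ?_) ?_
  · refine (norm_defectProd_sub_le (norm_revAvg_le_one ψ m (L m)) (L m) _).trans ?_
    have hterm : ∀ i ∈ Finset.range (L m), ‖revAvg ψ m (L m) i (basisVec γ)‖
        = (1 / 1024 : ℝ) ^ m * (1024 * (1 / 1024) ^ (L m - 1 - i + 1)) := by
      intro i hi
      have hi' := Finset.mem_range.1 hi
      have he : m + L m - 1 - i = m + (L m - 1 - i) := by omega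
      rw [revAvg, norm_avgOp_basisVec (by positivity) (hψ.injOn _), he, pow_succ, pow_add]
      push_cast
      rw [one_div_pow, one_div_pow]
      field_simp
    rw [Finset.sum_congr rfl hterm, ← Finset.mul_sum,
      Finset.sum_range_reflect (fun t => 1024 * (1 / 1024 : ℝ) ^ (t + 1)) (L m), ← Finset.mul_sum]
    gcongr
    linarith [sum_geometric_le (L m)]
  · simpa using (tendsto_pow_atTop_nhds_zero_of_lt_one (r := (1 / 1024 : ℝ)) (by norm_num)
      (by norm_num)).mul_const 2

theorem tendsto_normingOp (hψ : HasLongOrbits ψ) (L : ℕ → ℕ) {ω : VNt Γ →L[ℂ] ℂ}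
    (hω : ω ∈ APre Γ) : Tendsto (fun m => ω (normingOp ψ m (L m))) atTop (𝓝 0) := by
  let A : ℕ → (VNt Γ →L[ℂ] ℂ) →L[ℂ] ℂ := fun m =>
    ContinuousLinearMap.apply ℂ ℂ (normingOp ψ m (L m))
  have hA : ∀ m, ‖A m‖ ≤ 1 := fun m =>
    ContinuousLinearMap.opNorm_le_bound _ zero_le_one fun ω => by
      have := ω.le_opNorm (normingOp ψ m (L m))
      have h1 := norm_normingOp_le_one ψ m (L m)
      rw [one_mul]
      exact this.trans (mul_le_of_le_one_right (norm_nonneg _) h1)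
  have hle : APre Γ ≤ tendstoZeroSubmodule A := by
    refine Submodule.topologicalClosure_minimal _ (Submodule.span_le.2 ?_)
      (isClosed_tendstoZeroSubmodule A hA)
    rintro _ ⟨f, g, rfl⟩
    refine squeeze_zero_norm (fun m => ?_) ?_ (a := fun m =>
      ‖g‖ * ‖defectProd (revAvg ψ m (L m)) (L m) g - g‖
        + ‖f‖ * ‖defectProd (revAvg ψ m (L m)) (L m) f - f‖)
    · exact norm_inner_diagSum_le_of_defectProd (norm_revAvg_le_one ψ m (L m))
        (norm_revTrans_le_one ψ m (L m)) (L m) f g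
    · simpa using ((tendsto_defectProd_sub hψ L g).norm.const_mul ‖g‖).add
        ((tendsto_defectProd_sub hψ L f).norm.const_mul ‖f‖)
  exact hle hω

theorem progFunc_mem_AE {E : Set Γ} (k : ℕ)
    (hE : ∀ j : ℕ, 1 ≤ j → j ≤ 2 * (32 * 1024 ^ k) ^ 2 → ψ k ^ j ∈ E) :
    progFunc ψ k ∈ AE Γ E := by
  refine ⟨Submodule.le_topologicalClosure _ (Submodule.subset_span ⟨_, _, rfl⟩), ?_⟩
  intro γ hγ
  exact vecFunc_unitVec_eq_zero fun j h1 h2 h => hγ (h ▸ hE j h1 h2)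

theorem not_isReflexiveSp_AEt (hψ : HasLongOrbits ψ) {E : Set Γ}
    (hE : ∀ k j : ℕ, 1 ≤ j → j ≤ 2 * (32 * 1024 ^ k) ^ 2 → ψ k ^ j ∈ E) :
    ¬ IsReflexiveSp (AEt Γ E) := by
  classical
  intro hrefl
  let u : ℕ → AEt Γ E := fun k => ⟨progFunc ψ k, progFunc_mem_AE k (hE k)⟩
  obtain ⟨x, hx⟩ := exists_mem_closure_convexHull_tails hrefl u 1
    (fun k => norm_progFunc_le_one hψ k)
  have hL : ∀ m, ∃ L, 1 / 4 ≤ (x.1 (normingOp ψ m L)).re := by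
    intro m
    obtain ⟨v, hv, hxv⟩ := Metric.mem_closure_iff.1 (hx m) (1 / 4) (by norm_num)
    rw [convexHull_eq_union_convexHull_finite_subsets] at hv
    simp only [Set.mem_iUnion] at hv
    obtain ⟨t, ht, hvt⟩ := hv
    obtain ⟨s, hs, rfl⟩ := Finset.subset_set_image_iff.1 ht
    refine ⟨s.sup id + 1, ?_⟩
    set T := normingOp ψ m (s.sup id + 1)
    have hhull : 1 / 2 ≤ (v.1 T).re := by
      let ℓ : AEt Γ E →ₗ[ℝ] ℝ :=
        { toFun := fun y => (y.1 T).re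
          map_add' := fun y z => rfl
          map_smul' := fun c y => by
            change (((c : ℂ) • y.1) T).re = _
            simp }
      have hconv : Convex ℝ {y : AEt Γ E | 1 / 2 ≤ (y.1 T).re} :=
        convex_halfSpace_ge ℓ.isLinear _
      refine convexHull_min ?_ hconv hvt
      intro y hy
      obtain ⟨k, hk, rfl⟩ := Finset.mem_image.1 (Finset.mem_coe.1 hy)
      have hk' : k ≤ s.sup id := Finset.le_sup (f := id) hk
      exact half_le_re_progFunc_normingOp hψ (hs hk) (by omega)
    have hdist : ‖x.1 T - v.1 T‖ ≤ 1 / 4 := by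
      have h1 : ‖(x.1 - v.1) T‖ ≤ ‖x.1 - v.1‖ * ‖T‖ := (x.1 - v.1).le_opNorm T
      have h2 : ‖x.1 - v.1‖ < 1 / 4 := by rw [dist_eq_norm] at hxv; exact hxv
      have h3 : ‖T‖ ≤ 1 := norm_normingOp_le_one ψ m _
      calc ‖x.1 T - v.1 T‖ ≤ ‖x.1 - v.1‖ * ‖T‖ := h1
        _ ≤ 1 / 4 := by nlinarith [norm_nonneg (x.1 - v.1), norm_nonneg T]
    have h := (Complex.abs_re_le_norm _).trans hdist
    rw [abs_le, Complex.sub_re] at h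
    linarith [h.1]
  choose L hL using hL
  have hlim := (Complex.continuous_re.tendsto _).comp (tendsto_normingOp hψ L x.2.1)
  have := ge_of_tendsto' hlim hL
  norm_num at this

end Construction

/-- Let `Γ` be a discrete group and `{χ_n : n ∈ ℕ} ⊆ Γ` with the order
of `χ_n` strictly larger than `n` for each `n`.  Let `k(n)` be the order of `χ_n` if it is
finite and `n` otherwise, `F_n = {χ_n^j : 1 ≤ j ≤ k(n)}` and `E = ⋃_n F_n`.  Then the
closed ideal `A_E(Γ)` of the Fourier algebra `A(Γ)` is not reflexive.  (Here `orderOf x = 0`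
means that `x` has infinite order.) -/
theorem statement14 (Γ : Type) [Group Γ] (χ : ℕ → Γ)
    (horder : ∀ n : ℕ, orderOf (χ n) = 0 ∨ n < orderOf (χ n)) :
    ¬ IsReflexiveSp (AEt Γ
      (⋃ n : ℕ, (fun j : ℕ => χ n ^ j) ''
        {j : ℕ | 1 ≤ j ∧ j ≤ (if orderOf (χ n) = 0 then n else orderOf (χ n))})) := by
  have hinj : ∀ n, Set.InjOn (fun i : ℕ => χ n ^ i) (Set.Iio n) := by
    intro n
    rcases horder n with h | h
    · exact (injective_pow_iff_not_isOfFinOrder.2 (orderOf_eq_zero_iff.1 h)).injOn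
    · exact (pow_injOn_Iio_orderOf).mono (Set.Iio_subset_Iio h.le)
  refine not_isReflexiveSp_AEt (ψ := fun k => χ (2 * (32 * 1024 ^ k) ^ 2)) ?_ ?_
  · exact fun k => (hinj _).mono (Set.Iio_subset_Iio (by omega))
  · intro k j h1 h2
    refine Set.mem_iUnion.2 ⟨2 * (32 * 1024 ^ k) ^ 2, j, ⟨h1, h2.trans ?_⟩, rfl⟩
    split_ifs with h
    · exact le_rfl
    · exact ((horder _).resolve_left h).le
end
end

section
/- Let A be a Banach algebra and let J_B and J₁ be closed ideals of A such that J_B has a bounded approximate identity and is strongly Arens irregular, and J_B J₁ = J₁ J_B = {0}. Then the internal direct sum J₀ = J_B ⊕ J₁ is a closed ideal of A, and Z_i(J₀**) = Z_i(J_B**) + Z_i(J₁**) for i = 1, 2. -/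
noncomputable section

open Filter Topology

section ArensSetup

variable (A : Type*) [NonUnitalNormedRing A] [NormedSpace ℂ A]
  [IsScalarTower ℂ A A] [SMulCommClass ℂ A A]

/-- The module action `φ · a` of `A` on `A*`: `⟨φ · a, b⟩ = ⟨φ, a * b⟩`. -/
def dArR (φ : A →L[ℂ] ℂ) (a : A) : A →L[ℂ] ℂ :=
  φ.comp (ContinuousLinearMap.mul ℂ A a)

/-- The module action `a · φ` of `A` on `A*`: `⟨a · φ, b⟩ = ⟨φ, b * a⟩`. -/
def dArL (a : A) (φ : A →L[ℂ] ℂ) : A →L[ℂ] ℂ :=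
  φ.comp ((ContinuousLinearMap.mul ℂ A).flip a)

/-- `φ ↦ (a ↦ φ · a)`, bundled as a continuous linear map. -/
def dArRL : (A →L[ℂ] ℂ) →L[ℂ] A →L[ℂ] A →L[ℂ] ℂ :=
  ((ContinuousLinearMap.compL ℂ A (A →L[ℂ] A) (A →L[ℂ] ℂ)).flip
      (ContinuousLinearMap.mul ℂ A)).comp (ContinuousLinearMap.compL ℂ A A ℂ)

/-- `φ ↦ (a ↦ a · φ)`, bundled as a continuous linear map. -/
def dArLL : (A →L[ℂ] ℂ) →L[ℂ] A →L[ℂ] A →L[ℂ] ℂ :=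
  ((ContinuousLinearMap.compL ℂ A (A →L[ℂ] A) (A →L[ℂ] ℂ)).flip
      ((ContinuousLinearMap.mul ℂ A).flip)).comp (ContinuousLinearMap.compL ℂ A A ℂ)

/-- The module action `m · φ` of `A**` on `A*`: `⟨m · φ, a⟩ = ⟨m, φ · a⟩`. -/
def bdF (m : (A →L[ℂ] ℂ) →L[ℂ] ℂ) (φ : A →L[ℂ] ℂ) : A →L[ℂ] ℂ :=
  m.comp (dArRL A φ)

/-- The module action `φ · m` of `A**` on `A*`: `⟨φ · m, a⟩ = ⟨m, a · φ⟩`. -/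
def fBd (φ : A →L[ℂ] ℂ) (m : (A →L[ℂ] ℂ) →L[ℂ] ℂ) : A →L[ℂ] ℂ :=
  m.comp (dArLL A φ)

/-- The first Arens product on `A**`: `⟨m n, φ⟩ = ⟨m, n · φ⟩`. -/
def ar1 (m n : (A →L[ℂ] ℂ) →L[ℂ] ℂ) : (A →L[ℂ] ℂ) →L[ℂ] ℂ :=
  m.comp ((ContinuousLinearMap.compL ℂ A (A →L[ℂ] ℂ) ℂ n).comp (dArRL A))

/-- The second Arens product on `A**`: `⟨m ◊ n, φ⟩ = ⟨n, φ · m⟩`. -/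
def ar2 (m n : (A →L[ℂ] ℂ) →L[ℂ] ℂ) : (A →L[ℂ] ℂ) →L[ℂ] ℂ :=
  n.comp ((ContinuousLinearMap.compL ℂ A (A →L[ℂ] ℂ) ℂ m).comp (dArLL A))

/-- The canonical embedding of `A` into its bidual. -/
def ιA : A →L[ℂ] ((A →L[ℂ] ℂ) →L[ℂ] ℂ) := ContinuousLinearMap.apply ℂ ℂ

/-- The set of weakly almost periodic functionals: those `φ ∈ A*` for which `a ↦ a · φ`
is a weakly compact operator from `A` to `A*`. -/
def WAPset : Set (A →L[ℂ] ℂ) :=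
  {φ | IsCompact (closure
    ((fun a : A => (show WeakSpace ℂ (A →L[ℂ] ℂ) from dArL A a φ)) '' Metric.closedBall 0 1))}

/-- `u` is a bounded (two-sided) approximate identity along the filter `l`. -/
def IsBAIFor {ιt : Type*} (l : Filter ιt) (u : ιt → A) : Prop :=
  l.NeBot ∧ Bornology.IsBounded (Set.range u) ∧
    (∀ a : A, Tendsto (fun i => a * u i) l (𝓝 a)) ∧
    (∀ a : A, Tendsto (fun i => u i * a) l (𝓝 a))

/-- `A` has a bounded approximate identity. -/
def HasBAI : Prop := ∃ (ιt : Type) (l : Filter ιt) (u : ιt → A), IsBAIFor A l u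

/-- A mixed identity of `A**`: a right identity for the first Arens product and a left
identity for the second Arens product. -/
def IsMixedIdentity (e : (A →L[ℂ] ℂ) →L[ℂ] ℂ) : Prop :=
  (∀ m, ar1 A m e = m) ∧ (∀ m, ar2 A e m = m)

/-- `A` is a two-sided ideal in its bidual (with the first Arens product). -/
def IdealInBidual : Prop :=
  ∀ (m : (A →L[ℂ] ℂ) →L[ℂ] ℂ) (a : A),
    ar1 A m (ιA A a) ∈ Set.range (ιA A) ∧ ar1 A (ιA A a) m ∈ Set.range (ιA A)

/-- `A` is weakly sequentially complete. -/
def WeaklySequentiallyComplete : Prop :=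
  ∀ x : ℕ → A, (∀ φ : A →L[ℂ] ℂ, ∃ z : ℂ, Tendsto (fun n => φ (x n)) atTop (𝓝 z)) →
    ∃ a : A, ∀ φ : A →L[ℂ] ℂ, Tendsto (fun n => φ (x n)) atTop (𝓝 (φ a))

/-- The wsaBAI class: weakly sequentially complete, with a bounded approximate identity,
and an ideal in its bidual. -/
def IsWSABAI : Prop :=
  WeaklySequentiallyComplete A ∧ HasBAI A ∧ IdealInBidual A

/-- `J` is a closed two-sided ideal of `A`. -/
def IsClosedIdeal (J : Submodule ℂ A) : Prop :=
  IsClosed (J : Set A) ∧ (∀ b : A, ∀ a ∈ J, b * a ∈ J) ∧ (∀ b : A, ∀ a ∈ J, a * b ∈ J)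

/-- The canonical image `J^{⊥⊥}` of `J**` inside `A**`.  For a closed ideal `J` this
realizes the bidual of `J` (with its Arens products) inside `A**`. -/
def bidualOf (J : Submodule ℂ A) : Set ((A →L[ℂ] ℂ) →L[ℂ] ℂ) :=
  {s | ∀ φ : A →L[ℂ] ℂ, (∀ a ∈ J, φ a = 0) → s φ = 0}

/-- The first topological centre of a subset of `A**` (e.g. of `J** = bidualOf A J`). -/
def Z1in (S : Set ((A →L[ℂ] ℂ) →L[ℂ] ℂ)) : Set ((A →L[ℂ] ℂ) →L[ℂ] ℂ) :=
  {m ∈ S | ∀ n ∈ S, ar1 A m n = ar2 A m n}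

/-- The second topological centre of a subset of `A**`. -/
def Z2in (S : Set ((A →L[ℂ] ℂ) →L[ℂ] ℂ)) : Set ((A →L[ℂ] ℂ) →L[ℂ] ℂ) :=
  {m ∈ S | ∀ n ∈ S, ar1 A n m = ar2 A n m}

/-- The restriction map `i* : A* → J*` adjoint to the inclusion `i : J → A`. -/
def iStar (J : Submodule ℂ A) : (A →L[ℂ] ℂ) →L[ℂ] (↥J →L[ℂ] ℂ) :=
  (ContinuousLinearMap.compL ℂ ↥J A ℂ).flip J.subtypeL

/-- `i*(WAP(A))^⊥ = {r ∈ J** : ⟨r, i*(φ)⟩ = 0 for all φ ∈ WAP(A)}`, realized inside `A**`. -/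
def wapPerp (J : Submodule ℂ A) : Set ((A →L[ℂ] ℂ) →L[ℂ] ℂ) :=
  {r ∈ bidualOf A J | ∀ φ ∈ WAPset A, r φ = 0}

/-- `J` is a weak Riesz ideal: `J** · J* ∪ J* · J**` is contained in the norm closure
of `i*(WAP(A))` in `J*`. -/
def WeakRiesz (J : Submodule ℂ A) : Prop :=
  ∀ m ∈ bidualOf A J, ∀ ψ : A →L[ℂ] ℂ,
    iStar A J (bdF A m ψ) ∈ closure (iStar A J '' WAPset A) ∧
    iStar A J (fBd A ψ m) ∈ closure (iStar A J '' WAPset A)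

/-- `J` is a small-1-1 ideal: `e J** J** ⊆ J`. -/
def Small11 (J : Submodule ℂ A) (e : (A →L[ℂ] ℂ) →L[ℂ] ℂ) : Prop :=
  ∀ m ∈ bidualOf A J, ∀ n ∈ bidualOf A J,
    ar1 A e (ar1 A m n) ∈ ιA A '' (J : Set A)

/-- `J` is a Riesz ideal: `e J** = J** ◊ e = J`. -/
def RieszIdeal (J : Submodule ℂ A) (e : (A →L[ℂ] ℂ) →L[ℂ] ℂ) : Prop :=
  {s | ∃ m ∈ bidualOf A J, s = ar1 A e m} = ιA A '' (J : Set A) ∧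
  {s | ∃ m ∈ bidualOf A J, s = ar2 A m e} = ιA A '' (J : Set A)

/-- `J` has a bounded approximate identity (as a Banach algebra in its own right). -/
def HasBAIinIdeal (J : Submodule ℂ A) : Prop :=
  ∃ (ιt : Type) (l : Filter ιt) (u : ιt → A), l.NeBot ∧ Bornology.IsBounded (Set.range u) ∧
    (∀ i, u i ∈ J) ∧ (∀ a ∈ J, Tendsto (fun i => a * u i) l (𝓝 a)) ∧
    (∀ a ∈ J, Tendsto (fun i => u i * a) l (𝓝 a))

/-- `WAP(J)` as a subset of `J*`: those `ξ ∈ J*` such that `b ↦ b · ξ` is a weakly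
compact operator from `J` to `J*`.  The action is computed through any Hahn–Banach
extension `ψ ∈ A*` of `ξ` (for an ideal `J` the result does not depend on the extension). -/
def WAPJ (J : Submodule ℂ A) : Set (↥J →L[ℂ] ℂ) :=
  {ξ | ∃ ψ : A →L[ℂ] ℂ, iStar A J ψ = ξ ∧
    IsCompact (closure
      ((fun b : ↥J => (show WeakSpace ℂ (↥J →L[ℂ] ℂ) from iStar A J (dArL A (b : A) ψ))) ''
        Metric.closedBall 0 1))}

end ArensSetup

section ClosedIdeals

variable {A : Type*} [NonUnitalNormedRing A] [NormedSpace ℂ A]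

lemma zero_mem_bidualOf (J : Submodule ℂ A) : 0 ∈ bidualOf A J := fun _ _ => rfl

lemma bidualOf_mono {I J : Submodule ℂ A} (h : I ≤ J) : bidualOf A I ⊆ bidualOf A J :=
  fun _ hs φ hφ => hs φ fun a ha => hφ a (h ha)

lemma add_mem_bidualOf {J : Submodule ℂ A} {s t : (A →L[ℂ] ℂ) →L[ℂ] ℂ}
    (hs : s ∈ bidualOf A J) (ht : t ∈ bidualOf A J) : s + t ∈ bidualOf A J := fun φ hφ => by
  rw [add_apply, hs φ hφ, ht φ hφ, add_zero]

/-- The orthogonal sum of two closed ideals, one of which has a bounded approximate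
identity, is a closed ideal. -/
lemma isClosedIdeal_sup [CompleteSpace A] {I J : Submodule ℂ A} (hI : IsClosedIdeal A I)
    (hJ : IsClosedIdeal A J) (hbai : HasBAIinIdeal A I)
    (h : ∀ a ∈ I, ∀ b ∈ J, a * b = 0) : IsClosedIdeal A (I ⊔ J) := by
  refine ⟨?_, fun c x hx => ?_, fun c x hx => ?_⟩
  · obtain ⟨ι, l, u, hl, hb, huI, -, hu⟩ := hbai
    obtain ⟨M, hM⟩ := hb.exists_norm_le
    have hMnn : 0 ≤ M := by
      obtain ⟨i⟩ := hl.nonempty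
      exact (norm_nonneg _).trans (hM _ ⟨i, rfl⟩)
    have bound : ∀ a ∈ I, ∀ b ∈ J, ‖a‖ ≤ M * ‖a + b‖ := fun a ha b hb => by
      refine le_of_tendsto (hu a ha).norm (Eventually.of_forall fun i => ?_)
      have : u i * a = u i * (a + b) := by rw [mul_add, h _ (huI i) b hb, add_zero]
      rw [this]
      exact (norm_mul_le _ _).trans
        (mul_le_mul_of_nonneg_right (hM _ ⟨i, rfl⟩) (norm_nonneg _))
    have := hI.1.completeSpace_coe
    have := hJ.1.completeSpace_coe
    let f : (I × J) →L[ℂ] A := I.subtypeL.coprod J.subtypeL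
    have hf : AntilipschitzWith (M + 1).toNNReal f := by
      refine f.antilipschitz_of_bound fun x => ?_
      rw [Real.coe_toNNReal _ (by positivity)]
      have hx := bound x.1 x.1.2 x.2 x.2.2
      have hfx : f x = (x.1 : A) + x.2 := rfl
      have h2 : ‖(x.2 : A)‖ ≤ ‖f x‖ + ‖(x.1 : A)‖ := by
        have : (x.2 : A) = f x - x.1 := by rw [hfx, add_sub_cancel_left]
        rw [this]
        exact norm_sub_le _ _
      rw [← hfx] at hx
      have := norm_nonneg (f x)
      exact max_le (by rw [Submodule.coe_norm]; linarith) (by rw [Submodule.coe_norm]; linarith)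
    have hrange : Set.range f = ((I ⊔ J : Submodule ℂ A) : Set A) := by
      ext x
      simp [f, Submodule.mem_sup]
    rw [← hrange]
    exact hf.isClosed_range f.uniformContinuous
  · obtain ⟨a, ha, b, hb, rfl⟩ := Submodule.mem_sup.1 hx
    rw [mul_add]
    exact Submodule.add_mem_sup (hI.2.1 c a ha) (hJ.2.1 c b hb)
  · obtain ⟨a, ha, b, hb, rfl⟩ := Submodule.mem_sup.1 hx
    rw [add_mul]
    exact Submodule.add_mem_sup (hI.2.2 c a ha) (hJ.2.2 c b hb)

end ClosedIdeals

section ArensDirectSum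

variable {A : Type*} [NonUnitalNormedRing A] [NormedSpace ℂ A]
  [IsScalarTower ℂ A A] [SMulCommClass ℂ A A]

lemma ar1_add_left (m m' n : (A →L[ℂ] ℂ) →L[ℂ] ℂ) :
    ar1 A (m + m') n = ar1 A m n + ar1 A m' n := rfl

lemma ar2_add_right (m n n' : (A →L[ℂ] ℂ) →L[ℂ] ℂ) :
    ar2 A m (n + n') = ar2 A m n + ar2 A m n' := rfl

lemma ar1_add_right (m n n' : (A →L[ℂ] ℂ) →L[ℂ] ℂ) :
    ar1 A m (n + n') = ar1 A m n + ar1 A m n' := by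
  ext φ
  exact map_add m (bdF A n φ) (bdF A n' φ)

lemma ar2_add_left (m m' n : (A →L[ℂ] ℂ) →L[ℂ] ℂ) :
    ar2 A (m + m') n = ar2 A m n + ar2 A m' n := by
  ext φ
  exact map_add n (fBd A φ m) (fBd A φ m')

lemma ar1_zero_left (n : (A →L[ℂ] ℂ) →L[ℂ] ℂ) : ar1 A 0 n = 0 := rfl

lemma ar2_zero_right (m : (A →L[ℂ] ℂ) →L[ℂ] ℂ) : ar2 A m 0 = 0 := rfl

lemma ar1_zero_right (m : (A →L[ℂ] ℂ) →L[ℂ] ℂ) : ar1 A m 0 = 0 := by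
  ext φ
  exact map_zero m

lemma ar2_zero_left (n : (A →L[ℂ] ℂ) →L[ℂ] ℂ) : ar2 A 0 n = 0 := by
  ext φ
  exact map_zero n

/-- If `I J = 0` then `I** J** = 0` for the first Arens product. -/
lemma ar1_eq_zero {I J : Submodule ℂ A} (h : ∀ a ∈ I, ∀ b ∈ J, a * b = 0)
    {m n : (A →L[ℂ] ℂ) →L[ℂ] ℂ} (hm : m ∈ bidualOf A I) (hn : n ∈ bidualOf A J) :
    ar1 A m n = 0 := by
  ext φ
  refine hm (bdF A n φ) fun a ha => hn (dArR A φ a) fun b hb => ?_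
  simp [dArR, h a ha b hb]

/-- If `I J = 0` then `I** J** = 0` for the second Arens product. -/
lemma ar2_eq_zero {I J : Submodule ℂ A} (h : ∀ a ∈ I, ∀ b ∈ J, a * b = 0)
    {m n : (A →L[ℂ] ℂ) →L[ℂ] ℂ} (hm : m ∈ bidualOf A I) (hn : n ∈ bidualOf A J) :
    ar2 A m n = 0 := by
  ext φ
  refine hn (fBd A φ m) fun b hb => hm (dArL A b φ) fun a ha => ?_
  simp [dArL, h a ha b hb]

/-- Products in the bidual of an orthogonal sum are computed componentwise. -/
lemma ar1_add_add {I J : Submodule ℂ A} (h : ∀ a ∈ I, ∀ b ∈ J, a * b = 0 ∧ b * a = 0)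
    {m m' n n' : (A →L[ℂ] ℂ) →L[ℂ] ℂ} (hm : m ∈ bidualOf A I) (hm' : m' ∈ bidualOf A J)
    (hn : n ∈ bidualOf A I) (hn' : n' ∈ bidualOf A J) :
    ar1 A (m + m') (n + n') = ar1 A m n + ar1 A m' n' := by
  rw [ar1_add_left, ar1_add_right, ar1_add_right,
    ar1_eq_zero (fun a ha b hb => (h a ha b hb).1) hm hn',
    ar1_eq_zero (fun b hb a ha => (h a ha b hb).2) hm' hn, add_zero, zero_add]

lemma ar2_add_add {I J : Submodule ℂ A} (h : ∀ a ∈ I, ∀ b ∈ J, a * b = 0 ∧ b * a = 0)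
    {m m' n n' : (A →L[ℂ] ℂ) →L[ℂ] ℂ} (hm : m ∈ bidualOf A I) (hm' : m' ∈ bidualOf A J)
    (hn : n ∈ bidualOf A I) (hn' : n' ∈ bidualOf A J) :
    ar2 A (m + m') (n + n') = ar2 A m n + ar2 A m' n' := by
  rw [ar2_add_left, ar2_add_right, ar2_add_right,
    ar2_eq_zero (fun a ha b hb => (h a ha b hb).1) hm hn',
    ar2_eq_zero (fun b hb a ha => (h a ha b hb).2) hm' hn, add_zero, zero_add]

/-- A bounded approximate identity of `I` yields, as a weak*-cluster point, some `e ∈ A**` with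
`e · φ = φ` on `I`, and `e · φ = 0` on `J` whenever `J I = 0`. -/
lemma exists_bdF_eq_of_hasBAIinIdeal {I J : Submodule ℂ A} (hbai : HasBAIinIdeal A I)
    (h : ∀ a ∈ I, ∀ b ∈ J, b * a = 0) :
    ∃ e : (A →L[ℂ] ℂ) →L[ℂ] ℂ, ∀ φ : A →L[ℂ] ℂ,
      (∀ a ∈ I, bdF A e φ a = φ a) ∧ ∀ b ∈ J, bdF A e φ b = 0 := by
  obtain ⟨ι, l, u, hl, hb, huI, hr, -⟩ := hbai
  obtain ⟨M, hM⟩ := hb.exists_norm_le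
  let v : ι → WeakDual ℂ (A →L[ℂ] ℂ) := fun i => StrongDual.toWeakDual (ιA A (u i))
  have hcomp := WeakDual.isCompact_closedBall (𝕜 := ℂ) (0 : StrongDual ℂ (A →L[ℂ] ℂ)) M
  have hv : ∀ i, v i ∈ WeakDual.toStrongDual ⁻¹' Metric.closedBall
      (0 : StrongDual ℂ (A →L[ℂ] ℂ)) M := fun i => by
    refine (mem_closedBall_zero_iff (E := StrongDual ℂ (A →L[ℂ] ℂ))).2 ?_
    refine ContinuousLinearMap.opNorm_le_bound _
      ((norm_nonneg _).trans (hM _ ⟨i, rfl⟩)) fun φ => ?_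
    calc ‖φ (u i)‖ ≤ ‖φ‖ * ‖u i‖ := φ.le_opNorm _
      _ ≤ M * ‖φ‖ := by
        rw [mul_comm]
        exact mul_le_mul_of_nonneg_right (hM _ ⟨i, rfl⟩) (norm_nonneg _)
  obtain ⟨e, -, he⟩ := hcomp.ultrafilter_le_nhds ((Ultrafilter.of l).map v)
    (le_principal_iff.2 (mem_map.2 (Eventually.of_forall hv)))
  have hlim : ∀ ψ : A →L[ℂ] ℂ, Tendsto (fun i => ψ (u i)) (Ultrafilter.of l) (𝓝 (e ψ)) :=
    fun ψ => ((WeakDual.eval_continuous ψ).tendsto e).comp he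
  refine ⟨WeakDual.toStrongDual e, fun φ => ⟨fun a ha => ?_, fun b hb => ?_⟩⟩
  · exact tendsto_nhds_unique (hlim (dArR A φ a))
      ((φ.continuous.tendsto a).comp ((hr a ha).mono_left (Ultrafilter.of_le l)))
  · refine tendsto_nhds_unique (hlim (dArR A φ b)) ?_
    simp [dArR, h _ (huI _) b hb]

/-- `(I ⊕ J)** = I** + J**` for orthogonal `I`, `J` when `I` has a bounded approximate
identity. -/
lemma exists_add_of_mem_bidualOf_sup {I J : Submodule ℂ A} (hbai : HasBAIinIdeal A I)
    (h : ∀ a ∈ I, ∀ b ∈ J, b * a = 0) {s : (A →L[ℂ] ℂ) →L[ℂ] ℂ}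
    (hs : s ∈ bidualOf A (I ⊔ J)) :
    ∃ y ∈ bidualOf A I, ∃ z ∈ bidualOf A J, s = y + z := by
  obtain ⟨e, he⟩ := exists_bdF_eq_of_hasBAIinIdeal hbai h
  refine ⟨ar1 A s e, fun φ hφ => hs (bdF A e φ) fun x hx => ?_,
    s - ar1 A s e, fun φ hφ => ?_, by ext φ; simp⟩
  · obtain ⟨a, ha, b, hb, rfl⟩ := Submodule.mem_sup.1 hx
    rw [map_add, (he φ).1 a ha, (he φ).2 b hb, hφ a ha, add_zero]
  · have key : s (φ - bdF A e φ) = 0 := hs _ fun x hx => by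
      obtain ⟨a, ha, b, hb, rfl⟩ := Submodule.mem_sup.1 hx
      rw [sub_apply, map_add, map_add, (he φ).1 a ha, (he φ).2 b hb,
        hφ b hb, sub_self]
    rwa [map_sub] at key

lemma Z1in_bidualOf_sup {I J : Submodule ℂ A} (hbai : HasBAIinIdeal A I)
    (h : ∀ a ∈ I, ∀ b ∈ J, a * b = 0 ∧ b * a = 0) :
    Z1in A (bidualOf A (I ⊔ J)) =
      {x | ∃ y ∈ Z1in A (bidualOf A I), ∃ z ∈ Z1in A (bidualOf A J), x = y + z} := by
  have hdec {s} (hs : s ∈ bidualOf A (I ⊔ J)) :=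
    exists_add_of_mem_bidualOf_sup hbai (fun a ha b hb => (h a ha b hb).2) hs
  have hI0 := zero_mem_bidualOf I
  have hJ0 := zero_mem_bidualOf J
  ext x
  constructor
  · rintro ⟨hx, hc⟩
    obtain ⟨y, hy, z, hz, rfl⟩ := hdec hx
    refine ⟨y, ⟨hy, fun n hn => ?_⟩, z, ⟨hz, fun n hn => ?_⟩, rfl⟩
    · have key := hc (n + 0) (by simpa using bidualOf_mono le_sup_left hn)
      rwa [ar1_add_add h hy hz hn hJ0, ar2_add_add h hy hz hn hJ0,
        ar1_zero_right, ar2_zero_right, add_zero, add_zero] at key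
    · have key := hc (0 + n) (by simpa using bidualOf_mono le_sup_right hn)
      rwa [ar1_add_add h hy hz hI0 hn, ar2_add_add h hy hz hI0 hn,
        ar1_zero_right, ar2_zero_right, zero_add, zero_add] at key
  · rintro ⟨y, ⟨hy, hyc⟩, z, ⟨hz, hzc⟩, rfl⟩
    refine ⟨add_mem_bidualOf (bidualOf_mono le_sup_left hy) (bidualOf_mono le_sup_right hz),
      fun x hx => ?_⟩
    obtain ⟨n, hn, n', hn', rfl⟩ := hdec hx
    rw [ar1_add_add h hy hz hn hn', ar2_add_add h hy hz hn hn', hyc n hn, hzc n' hn']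

lemma Z2in_bidualOf_sup {I J : Submodule ℂ A} (hbai : HasBAIinIdeal A I)
    (h : ∀ a ∈ I, ∀ b ∈ J, a * b = 0 ∧ b * a = 0) :
    Z2in A (bidualOf A (I ⊔ J)) =
      {x | ∃ y ∈ Z2in A (bidualOf A I), ∃ z ∈ Z2in A (bidualOf A J), x = y + z} := by
  have hdec {s} (hs : s ∈ bidualOf A (I ⊔ J)) :=
    exists_add_of_mem_bidualOf_sup hbai (fun a ha b hb => (h a ha b hb).2) hs
  have hI0 := zero_mem_bidualOf I
  have hJ0 := zero_mem_bidualOf J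
  ext x
  constructor
  · rintro ⟨hx, hc⟩
    obtain ⟨y, hy, z, hz, rfl⟩ := hdec hx
    refine ⟨y, ⟨hy, fun n hn => ?_⟩, z, ⟨hz, fun n hn => ?_⟩, rfl⟩
    · have key := hc (n + 0) (by simpa using bidualOf_mono le_sup_left hn)
      rwa [ar1_add_add h hn hJ0 hy hz, ar2_add_add h hn hJ0 hy hz,
        ar1_zero_left, ar2_zero_left, add_zero, add_zero] at key
    · have key := hc (0 + n) (by simpa using bidualOf_mono le_sup_right hn)
      rwa [ar1_add_add h hI0 hn hy hz, ar2_add_add h hI0 hn hy hz,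
        ar1_zero_left, ar2_zero_left, zero_add, zero_add] at key
  · rintro ⟨y, ⟨hy, hyc⟩, z, ⟨hz, hzc⟩, rfl⟩
    refine ⟨add_mem_bidualOf (bidualOf_mono le_sup_left hy) (bidualOf_mono le_sup_right hz),
      fun x hx => ?_⟩
    obtain ⟨n, hn, n', hn', rfl⟩ := hdec hx
    rw [ar1_add_add h hn hn' hy hz, ar2_add_add h hn hn' hy hz, hyc n hn, hzc n' hn']

end ArensDirectSum

/-- Let `A` be a Banach algebra and let `J_B` and `J₁` be closed ideals
of `A` such that `J_B` has a bounded approximate identity and is strongly Arens irregular,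
and `J_B J₁ = J₁ J_B = {0}`.  Then the internal direct sum `J₀ = J_B ⊕ J₁` is a closed
ideal and `Z_i(J₀**) = Z_i(J_B**) + Z_i(J₁**)` for `i = 1, 2`.  (Biduals of ideals and
their topological centres are realized canonically inside `A**` via `bidualOf`.) -/
theorem statement17 (A : Type*) [NonUnitalNormedRing A] [NormedSpace ℂ A]
    [IsScalarTower ℂ A A] [SMulCommClass ℂ A A] [CompleteSpace A]
    (JB J1 : Submodule ℂ A) (hJB : IsClosedIdeal A JB) (hJ1 : IsClosedIdeal A J1)
    (hbai : HasBAIinIdeal A JB)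
    (hsAir : Z1in A (bidualOf A JB) = ιA A '' (JB : Set A) ∧
             Z2in A (bidualOf A JB) = ιA A '' (JB : Set A))
    (horth : ∀ a ∈ JB, ∀ b ∈ J1, a * b = 0 ∧ b * a = 0) :
    IsClosedIdeal A (JB ⊔ J1) ∧
    Z1in A (bidualOf A (JB ⊔ J1)) =
      {x | ∃ y ∈ Z1in A (bidualOf A JB), ∃ z ∈ Z1in A (bidualOf A J1), x = y + z} ∧
    Z2in A (bidualOf A (JB ⊔ J1)) =
      {x | ∃ y ∈ Z2in A (bidualOf A JB), ∃ z ∈ Z2in A (bidualOf A J1), x = y + z} := by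
  exact ⟨isClosedIdeal_sup hJB hJ1 hbai fun a ha b hb => (horth a ha b hb).1,
    Z1in_bidualOf_sup hbai horth, Z2in_bidualOf_sup hbai horth⟩
end
end
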